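/- Let G be a spray on a nonempty open set U ⊆ ℝ^n with n ≥ 3. If G is of scalar curvature, i.e. its Weyl curvature vanishes identically (W^i_k = 0 for all i,k), then for every volume form dV on U the Berwald–Weyl curvature of (G,dV) vanishes: W^o_k = 0 for all k. -/

import Mathlib

open scoped BigOperators
open MeasureTheory

noncomputable section BerwaldWeyl

/-- Points/vectors in local coordinates on `ℝⁿ`. -/
abbrev Vec (n : ℕ) := Fin n → ℝ

/-- Partial derivative in the base (`x`) variable along the `i`-th coordinate. -/
def pdx {n : ℕ} (f : Vec n → Vec n → ℝ) (i : Fin n) : Vec n → Vec n → ℝ :=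
  fun x y => fderiv ℝ (fun x' => f x' y) x (Pi.single i 1)

/-- Vertical derivative `f_{·i} = ∂f/∂y^i`. -/
def pdy {n : ℕ} (f : Vec n → Vec n → ℝ) (i : Fin n) : Vec n → Vec n → ℝ :=
  fun x y => fderiv ℝ (fun y' => f x y') y (Pi.single i 1)

/-- The slit fiber `ℝⁿ \ {0}`. -/
def slit (n : ℕ) : Set (Vec n) := {y | y ≠ 0}

/-- A spray on `U ⊆ ℝⁿ`: a family `G^i(x,y)`, smooth on `U × (ℝⁿ \ {0})` and
positively 2-homogeneous in `y`. -/
def IsSpray {n : ℕ} (U : Set (Vec n)) (G : Fin n → Vec n → Vec n → ℝ) : Prop :=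
  (∀ i, ContDiffOn ℝ (⊤ : ℕ∞) (fun p : Vec n × Vec n => G i p.1 p.2) (U ×ˢ slit n)) ∧
  (∀ i, ∀ x ∈ U, ∀ y ∈ slit n, ∀ c : ℝ, 0 < c → G i x (c • y) = c ^ 2 * G i x y)

/-- Nonlinear connection coefficients `N^i_j := ∂G^i/∂y^j`. -/
def Nc {n : ℕ} (G : Fin n → Vec n → Vec n → ℝ) (i j : Fin n) : Vec n → Vec n → ℝ :=
  pdy (G i) j

/-- Berwald connection coefficients `Γ^i_{jk} := ∂²G^i/∂y^j∂y^k`. -/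
def Γc {n : ℕ} (G : Fin n → Vec n → Vec n → ℝ) (i j k : Fin n) : Vec n → Vec n → ℝ :=
  pdy (pdy (G i) j) k

/-- Horizontal derivative of a scalar: `f_{|k} := δf/δx^k = ∂f/∂x^k - N^l_k ∂f/∂y^l`. -/
def hD {n : ℕ} (G : Fin n → Vec n → Vec n → ℝ) (f : Vec n → Vec n → ℝ) (k : Fin n) :
    Vec n → Vec n → ℝ :=
  fun x y => pdx f k x y - ∑ l, Nc G l k x y * pdy f l x y

/-- Horizontal covariant derivative `A_{j|m}` of a 1-form `A_j`. -/
def covD1 {n : ℕ} (G : Fin n → Vec n → Vec n → ℝ) (A : Fin n → Vec n → Vec n → ℝ)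
    (j m : Fin n) : Vec n → Vec n → ℝ :=
  fun x y => hD G (A j) m x y - ∑ l, A l x y * Γc G l j m x y

/-- Horizontal covariant derivative `A^i_{j|m}` of a (1,1)-tensor `A^i_j`. -/
def covD11 {n : ℕ} (G : Fin n → Vec n → Vec n → ℝ)
    (A : Fin n → Fin n → Vec n → Vec n → ℝ) (i j m : Fin n) : Vec n → Vec n → ℝ :=
  fun x y => hD G (A i j) m x y + ∑ l, A l j x y * Γc G i l m x y
    - ∑ l, A i l x y * Γc G l j m x y

/-- Horizontal covariant derivative `B^i_{jk|m}` of a (1,2)-tensor `B^i_{jk}`. -/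
def covD12 {n : ℕ} (G : Fin n → Vec n → Vec n → ℝ)
    (B : Fin n → Fin n → Fin n → Vec n → Vec n → ℝ) (i j k m : Fin n) : Vec n → Vec n → ℝ :=
  fun x y => hD G (B i j k) m x y + ∑ l, B l j k x y * Γc G i l m x y
    - ∑ l, B i l k x y * Γc G l j m x y - ∑ l, B i j l x y * Γc G l k m x y

/-- Riemann curvature `R^i_k`. -/
def Riem {n : ℕ} (G : Fin n → Vec n → Vec n → ℝ) (i k : Fin n) : Vec n → Vec n → ℝ :=
  fun x y => 2 * pdx (G i) k x y - ∑ j, y j * pdy (pdx (G i) j) k x y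
    + 2 * ∑ j, G j x y * Γc G i j k x y - ∑ s, Nc G i s x y * Nc G s k x y

/-- Ricci scalar `R := R^m_m/(n-1)`. -/
def Ricci {n : ℕ} (G : Fin n → Vec n → Vec n → ℝ) : Vec n → Vec n → ℝ :=
  fun x y => (∑ m, Riem G m m x y) / ((n : ℝ) - 1)

/-- The Weyl-type curvature `T^i_k := R^i_k - (R δ^i_k - ½ R_{·k} y^i)`. -/
def Tcurv {n : ℕ} (G : Fin n → Vec n → Vec n → ℝ) (i k : Fin n) : Vec n → Vec n → ℝ :=
  fun x y => Riem G i k x y -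
    (Ricci G x y * (if i = k then 1 else 0) - (1/2) * pdy (Ricci G) k x y * y i)

/-- The χ-curvature `χ_i := -(1/3) T^m_{i·m}`. -/
def chiC {n : ℕ} (G : Fin n → Vec n → Vec n → ℝ) (i : Fin n) : Vec n → Vec n → ℝ :=
  fun x y => -(1/3) * ∑ m, pdy (Tcurv G m i) m x y

/-- The Weyl curvature `W^i_k := T^i_k + (3χ_k/(n+1)) y^i`. -/
def Weyl {n : ℕ} (G : Fin n → Vec n → Vec n → ℝ) (i k : Fin n) : Vec n → Vec n → ℝ :=
  fun x y => Tcurv G i k x y + (3 * chiC G k x y / ((n : ℝ) + 1)) * y i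

/-- A volume form `dV = σ(x) dx` on `U`: `σ` smooth and positive. -/
def IsVolumeForm {n : ℕ} (U : Set (Vec n)) (σ : Vec n → ℝ) : Prop :=
  ContDiffOn ℝ (⊤ : ℕ∞) σ U ∧ ∀ x ∈ U, 0 < σ x

/-- The S-curvature of `(G, dV)`: `S := ∂G^m/∂y^m - y^m ∂(ln σ)/∂x^m`. -/
def Scurv {n : ℕ} (G : Fin n → Vec n → Vec n → ℝ) (σ : Vec n → ℝ) : Vec n → Vec n → ℝ :=
  fun x y => ∑ m, Nc G m m x y
    - ∑ m, y m * fderiv ℝ (fun x' => Real.log (σ x')) x (Pi.single m 1)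

/-- The projective spray `Ĝ^i := G^i - (S/(n+1)) y^i` of `(G, dV)`. -/
def Ghat {n : ℕ} (G : Fin n → Vec n → Vec n → ℝ) (σ : Vec n → ℝ) :
    Fin n → Vec n → Vec n → ℝ :=
  fun i x y => G i x y - (Scurv G σ x y / ((n : ℝ) + 1)) * y i

/-- The Berwald–Weyl curvature `W^o_k := R̂_{∥k} - ½ R̂_{·k∥m} y^m` of `(G, dV)`,
where all hatted quantities and `∥` are taken with respect to the projective spray `Ĝ`. -/
def BWeyl {n : ℕ} (G : Fin n → Vec n → Vec n → ℝ) (σ : Vec n → ℝ) (k : Fin n) :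
    Vec n → Vec n → ℝ :=
  fun x y => hD (Ghat G σ) (Ricci (Ghat G σ)) k x y
    - (1/2) * ∑ m, covD1 (Ghat G σ) (fun j => pdy (Ricci (Ghat G σ)) j) k m x y * y m


/-- Commuting horizontal and vertical partial derivatives on an algebra of functions of `(x, y)`. -/
structure SlitCalculus (A : Type*) [CommRing A] [Algebra ℝ A] (n : ℕ) where
  X : Fin n → Derivation ℝ A A
  Y : Fin n → Derivation ℝ A A
  y : Fin n → A
  X_comm : ∀ i j a, X i (X j a) = X j (X i a)
  Y_comm : ∀ i j a, Y i (Y j a) = Y j (Y i a)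
  YX_comm : ∀ i j a, Y i (X j a) = X j (Y i a)
  X_y : ∀ i j, X i (y j) = 0
  Y_y : ∀ i j, Y i (y j) = if j = i then 1 else 0

namespace Derivation

variable {A : Type*} [CommRing A] [Algebra ℝ A]

theorem finset_sum_apply {ι : Type*} (s : Finset ι) (D : ι → Derivation ℝ A A) (a : A) :
    (∑ i ∈ s, D i) a = ∑ i ∈ s, D i a := by
  rw [← coeFnAddMonoidHom_apply, map_sum, Finset.sum_apply]
  rfl

theorem map_ofNat (D : Derivation ℝ A A) (k : ℕ) [k.AtLeastTwo] : D ofNat(k) = 0 :=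
  D.map_natCast k

theorem map_two_mul (D : Derivation ℝ A A) (a : A) : D (2 * a) = 2 * D a := by
  simp [leibniz, map_ofNat]

theorem map_three_mul (D : Derivation ℝ A A) (a : A) : D (3 * a) = 3 * D a := by
  simp [leibniz, map_ofNat]

theorem map_algebraMap_mul (D : Derivation ℝ A A) (r : ℝ) (a : A) :
    D (algebraMap ℝ A r * a) = algebraMap ℝ A r * D a := by
  simp [leibniz]

end Derivation

namespace SlitCalculus

variable {A : Type*} [CommRing A] [Algebra ℝ A] {n : ℕ} (C : SlitCalculus A n)

/-- The Euler (Liouville) vector field. -/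
def euler : Derivation ℝ A A := ∑ i, C.y i • C.Y i

theorem euler_apply (a : A) : C.euler a = ∑ i, C.y i * C.Y i a := by
  simp only [euler, Derivation.finset_sum_apply, Derivation.coe_smul, Pi.smul_apply, smul_eq_mul]

theorem euler_y (i : Fin n) : C.euler (C.y i) = C.y i := by
  simp [euler_apply, Y_y]

theorem euler_X (i : Fin n) (a : A) : C.euler (C.X i a) = C.X i (C.euler a) := by
  simp [euler_apply, X_y, YX_comm]

theorem euler_Y (i : Fin n) (a : A) : C.euler (C.Y i a) = C.Y i (C.euler a) - C.Y i a := by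
  simp [euler_apply, Y_y, C.Y_comm i, Finset.sum_add_distrib]

variable (G : Fin n → A)

/-- The nonlinear connection coefficients. -/
def conn (i k : Fin n) : A := C.Y k (G i)

/-- The Berwald connection coefficients. -/
def berwald (i j k : Fin n) : A := C.Y k (C.Y j (G i))

/-- The horizontal vector fields. -/
def hor (k : Fin n) : Derivation ℝ A A := C.X k - ∑ l, C.conn G l k • C.Y l

/-- The curvature of the nonlinear connection. -/
def curv (i k l : Fin n) : A := C.hor G k (C.conn G i l) - C.hor G l (C.conn G i k)

/-- The Riemann curvature of a spray. -/
def riem (i k : Fin n) : A :=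
  2 * C.X k (G i) - ∑ j, C.y j * C.Y k (C.X j (G i))
    + 2 * ∑ j, G j * C.berwald G i j k - ∑ s, C.conn G i s * C.conn G s k

theorem hor_apply (k : Fin n) (a : A) :
    C.hor G k a = C.X k a - ∑ l, C.conn G l k * C.Y l a := by
  simp only [hor, Derivation.coe_sub, Derivation.finset_sum_apply, Derivation.coe_smul, Pi.sub_apply,
    Pi.smul_apply, smul_eq_mul]

theorem berwald_symm (i j k : Fin n) : C.berwald G i j k = C.berwald G i k j := C.Y_comm ..

theorem Y_conn (i j k : Fin n) : C.Y k (C.conn G i j) = C.berwald G i j k := rfl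

theorem hor_y (i k : Fin n) : C.hor G k (C.y i) = - C.conn G i k := by
  simp [hor_apply, X_y, Y_y]

theorem Y_hor (m s : Fin n) (a : A) :
    C.Y s (C.hor G m a) = C.hor G m (C.Y s a) - ∑ t, C.berwald G t m s * C.Y t a := by
  simp only [hor_apply, map_sub, map_sum, Derivation.leibniz, smul_eq_mul, YX_comm, Y_conn,
    C.Y_comm s, Finset.sum_add_distrib, mul_comm]
  ring

theorem hor_hor (k l : Fin n) (a : A) :
    C.hor G k (C.hor G l a) - C.hor G l (C.hor G k a) = - ∑ s, C.curv G s k l * C.Y s a := by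
  have key (k l : Fin n) : C.hor G k (C.hor G l a) = C.hor G k (C.X l a)
      - ∑ s, (C.hor G k (C.conn G s l) * C.Y s a)
      - ∑ s, C.conn G s l * C.X k (C.Y s a)
      + ∑ s, ∑ t, C.conn G s l * (C.conn G t k * C.Y t (C.Y s a)) := by
    rw [C.hor_apply G l, map_sub, map_sum]
    simp only [Derivation.leibniz, smul_eq_mul, Finset.sum_add_distrib, C.hor_apply G k (C.Y _ a),
      mul_sub, Finset.sum_sub_distrib, Finset.mul_sum, mul_comm (C.Y _ a)]
    ring
  have h2 : ∑ s, ∑ t, C.conn G s l * (C.conn G t k * C.Y t (C.Y s a))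
      = ∑ s, ∑ t, C.conn G s k * (C.conn G t l * C.Y t (C.Y s a)) := by
    rw [Finset.sum_comm]
    refine Finset.sum_congr rfl fun s _ => Finset.sum_congr rfl fun t _ => ?_
    rw [C.Y_comm]; ring
  rw [key k l, key l k, h2]
  simp only [curv, sub_mul, Finset.sum_sub_distrib, C.hor_apply G _ (C.X _ a), C.YX_comm,
    C.X_comm k l]
  ring

theorem curv_antisymm (i k l : Fin n) : C.curv G i k l = - C.curv G i l k := by
  simp [curv]

/-- The second Bianchi identity. -/
theorem bianchi_hor (i m k l : Fin n) :
    (C.hor G m (C.curv G i k l) + ∑ s, C.curv G s k l * C.berwald G i m s)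
    + (C.hor G k (C.curv G i l m) + ∑ s, C.curv G s l m * C.berwald G i k s)
    + (C.hor G l (C.curv G i m k) + ∑ s, C.curv G s m k * C.berwald G i l s) = 0 := by
  have h1 := C.hor_hor G m k (C.conn G i l)
  have h2 := C.hor_hor G k l (C.conn G i m)
  have h3 := C.hor_hor G l m (C.conn G i k)
  simp only [Y_conn] at h1 h2 h3
  have h (m k l : Fin n) : C.hor G m (C.curv G i k l)
      = C.hor G m (C.hor G k (C.conn G i l)) - C.hor G m (C.hor G l (C.conn G i k)) := map_sub ..
  rw [h, h, h]
  linear_combination h1 + h2 + h3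

theorem Y_curv (i j k l : Fin n) : C.Y j (C.curv G i k l) =
    C.hor G k (C.berwald G i l j) - C.hor G l (C.berwald G i k j)
    - ∑ t, C.berwald G t k j * C.berwald G i l t + ∑ t, C.berwald G t l j * C.berwald G i k t := by
  simp only [curv, map_sub, Y_hor, Y_conn]
  ring

/-- The first Bianchi identity. -/
theorem bianchi_vert (i j k l : Fin n) :
    C.Y j (C.curv G i k l) + C.Y k (C.curv G i l j) + C.Y l (C.curv G i j k) = 0 := by
  simp only [Y_curv, C.berwald_symm G _ l j, C.berwald_symm G _ k j, C.berwald_symm G _ l k]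
  ring

theorem trace_Y_curv (k l : Fin n) : ∑ m, C.Y m (C.curv G m k l) =
    C.hor G k (C.Y l (∑ m, C.conn G m m)) - C.hor G l (C.Y k (∑ m, C.conn G m m)) := by
  have h : ∑ m, ∑ t, C.berwald G t k m * C.berwald G m l t
      = ∑ m, ∑ t, C.berwald G t l m * C.berwald G m k t := by
    rw [Finset.sum_comm]
    exact Finset.sum_congr rfl fun s _ => Finset.sum_congr rfl fun t _ => by ring
  simp only [Y_curv, Finset.sum_add_distrib, Finset.sum_sub_distrib, h, map_sum, Y_conn]
  simp only [C.berwald_symm G _ l, C.berwald_symm G _ k, sub_add_cancel]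

variable {G}

theorem euler_conn (hG : ∀ i, C.euler (G i) = 2 * G i) (i k : Fin n) :
    C.euler (C.conn G i k) = C.conn G i k := by
  simp only [conn, euler_Y, hG, Derivation.map_two_mul]
  ring

theorem euler_hor (hG : ∀ i, C.euler (G i) = 2 * G i) (k : Fin n) (a : A) :
    C.euler (C.hor G k a) = C.hor G k (C.euler a) := by
  simp only [hor_apply, map_sub, map_sum, Derivation.leibniz, smul_eq_mul, euler_X, euler_Y,
    C.euler_conn hG, mul_sub, Finset.sum_add_distrib, Finset.sum_sub_distrib, mul_comm]
  ring

theorem euler_curv (hG : ∀ i, C.euler (G i) = 2 * G i) (i k l : Fin n) :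
    C.euler (C.curv G i k l) = C.curv G i k l := by
  simp only [curv, map_sub, C.euler_hor hG, C.euler_conn hG]

theorem riem_eq (hG : ∀ i, C.euler (G i) = 2 * G i) (i k : Fin n) :
    C.riem G i k = ∑ l, C.curv G i k l * C.y l := by
  have h1 : ∑ l, C.hor G k (C.conn G i l) * C.y l
      = 2 * C.hor G k (G i) + ∑ l, C.conn G i l * C.conn G l k := by
    have h := congrArg (C.hor G k) (hG i)
    rw [Derivation.map_two_mul] at h
    simp only [euler_apply, map_sum, Derivation.leibniz, smul_eq_mul, hor_y,
      Finset.sum_add_distrib, mul_neg, Finset.sum_neg_distrib] at h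
    simp only [mul_comm _ (C.y _)]
    simp only [conn] at h ⊢
    linear_combination h
  have h2 : ∑ l, C.hor G l (C.conn G i k) * C.y l
      = (∑ j, C.y j * C.Y k (C.X j (G i))) - 2 * ∑ j, G j * C.berwald G i j k := by
    simp only [hor_apply, sub_mul, Finset.sum_sub_distrib, Finset.sum_mul]
    rw [Finset.sum_comm]
    congr 1
    · exact Finset.sum_congr rfl fun j _ => by rw [YX_comm, mul_comm]; rfl
    · rw [Finset.mul_sum]
      refine Finset.sum_congr rfl fun j _ => ?_
      have h := hG j
      rw [euler_apply] at h
      rw [Y_conn, ← mul_assoc, ← h, Finset.sum_mul]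
      refine Finset.sum_congr rfl fun l _ => ?_
      rw [C.berwald_symm]
      simp only [conn]
      ring
  simp only [curv, sub_mul, Finset.sum_sub_distrib, h1, h2]
  rw [riem, C.hor_apply G k (G i)]
  have h3 : ∑ l, C.conn G l k * C.Y l (G i) = ∑ s, C.conn G i s * C.conn G s k :=
    Finset.sum_congr rfl fun s _ => mul_comm _ _
  rw [h3]
  ring

theorem three_mul_curv (hG : ∀ i, C.euler (G i) = 2 * G i) (i k l : Fin n) :
    3 * C.curv G i k l = C.Y l (C.riem G i k) - C.Y k (C.riem G i l) := by
  have h : ∑ j, C.y j * C.Y l (C.curv G i k j) - ∑ j, C.y j * C.Y k (C.curv G i l j)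
      = C.curv G i k l := by
    rw [← C.euler_curv hG i k l, euler_apply, ← Finset.sum_sub_distrib]
    refine Finset.sum_congr rfl fun j _ => ?_
    have h := C.bianchi_vert G i j k l
    rw [C.curv_antisymm G i j k, map_neg] at h
    linear_combination (-C.y j) * h
  simp only [C.riem_eq hG, map_sum, Derivation.leibniz, smul_eq_mul, Y_y,
    Finset.sum_add_distrib, mul_ite, mul_one, mul_zero, Finset.sum_ite_eq', Finset.mem_univ,
    if_true]
  linear_combination C.curv_antisymm G i k l - h


theorem eq_zero_of_algebraMap_mul {r : ℝ} (hr : r ≠ 0) {a : A} (h : algebraMap ℝ A r * a = 0) :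
    a = 0 := by
  rw [← Algebra.smul_def] at h
  exact (smul_eq_zero.mp h).resolve_left hr

theorem three_mul_curv_of_isotropic (hG : ∀ i, C.euler (G i) = 2 * G i) {R : A} {θ : Fin n → A}
    (h : ∀ i k, C.riem G i k = R * (if i = k then 1 else 0) + θ k * C.y i) (i k l : Fin n) :
    3 * C.curv G i k l = (if i = k then C.Y l R - θ l else 0) - (if i = l then C.Y k R - θ k else 0)
      + (C.Y l (θ k) - C.Y k (θ l)) * C.y i := by
  rw [C.three_mul_curv hG, h, h]
  simp only [map_add, Derivation.leibniz, smul_eq_mul, Y_y]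
  split_ifs <;> simp <;> ring

/-- The change of curvature under a projective change of sprays. -/
theorem curv_proj (hG : ∀ i, C.euler (G i) = 2 * G i) {P : A} (hP : C.euler P = P) {G' : Fin n → A}
    (hG' : ∀ i, G' i = G i + P * C.y i) (i k l : Fin n) :
    C.curv G' i k l = C.curv G i k l
      + (C.hor G k (C.Y l P) - C.hor G l (C.Y k P)) * C.y i
      + (if i = k then P * C.Y l P - C.hor G l P else 0)
      - (if i = l then P * C.Y k P - C.hor G k P else 0) := by
  have hN (i k : Fin n) : C.conn G' i k = C.conn G i k + C.Y k P * C.y i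
      + P * (if i = k then 1 else 0) := by
    simp only [conn, hG', map_add, Derivation.leibniz, smul_eq_mul, Y_y]
    ring
  have hδ (k : Fin n) (a : A) : C.hor G' k a = C.hor G k a - C.Y k P * C.euler a - P * C.Y k a := by
    simp only [hor_apply, hN, add_mul, Finset.sum_add_distrib, euler_apply, Finset.mul_sum]
    simp [mul_assoc, sub_sub, add_assoc]
  have hY (k l : Fin n) : C.Y k (if i = l then (1 : A) else 0) = 0 := by split_ifs <;> simp
  have hH (k l : Fin n) : C.hor G k (if i = l then (1 : A) else 0) = 0 := by split_ifs <;> simp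
  have hE (l : Fin n) : C.euler (if i = l then (1 : A) else 0) = 0 := by split_ifs <;> simp
  simp only [curv, hδ, hN, map_add, Derivation.leibniz, smul_eq_mul, hY, hH, hE, hor_y, Y_y,
    euler_Y, euler_y, hP, C.euler_conn hG, Y_conn, C.berwald_symm G i l k, C.Y_comm l k]
  split_ifs <;> ring

theorem euler_proj (hG : ∀ i, C.euler (G i) = 2 * G i) {P : A} (hP : C.euler P = P)
    {G' : Fin n → A} (hG' : ∀ i, G' i = G i + P * C.y i) (i : Fin n) :
    C.euler (G' i) = 2 * G' i := by
  simp only [hG', map_add, hG, Derivation.leibniz, hP, euler_y, smul_eq_mul]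
  ring

/-- Isotropy of the Riemann curvature modulo `y` is a projective invariant. -/
theorem exists_isotropic_proj (hG : ∀ i, C.euler (G i) = 2 * G i) {R : A} {θ : Fin n → A}
    (hR : C.euler R = 2 * R) (hθ : ∀ k, C.euler (θ k) = θ k)
    (h : ∀ i k, C.riem G i k = R * (if i = k then 1 else 0) + θ k * C.y i)
    {P : A} (hP : C.euler P = P) {G' : Fin n → A} (hG' : ∀ i, G' i = G i + P * C.y i) :
    ∃ (R' : A) (θ' : Fin n → A), (∀ k, C.euler (θ' k) = θ' k) ∧ ∑ k, θ' k * C.y k = -R' ∧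
      ∀ i k, C.riem G' i k = R' * (if i = k then 1 else 0) + θ' k * C.y i := by
  set r : Fin n → A := fun l => C.Y l R - θ l + 3 * (P * C.Y l P - C.hor G l P) with hr
  set a : Fin n → Fin n → A := fun k l =>
    C.Y l (θ k) - C.Y k (θ l) + 3 * (C.hor G k (C.Y l P) - C.hor G l (C.Y k P)) with ha
  have hcurv (i k l : Fin n) : 3 * C.curv G' i k l
      = (if i = k then r l else 0) - (if i = l then r k else 0) + a k l * C.y i := by
    rw [C.curv_proj hG hP hG']
    have := C.three_mul_curv_of_isotropic hG h i k l
    simp only [hr, ha]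
    split_ifs at this ⊢ <;> linear_combination this
  have hEr (l : Fin n) : C.euler (r l) = r l := by
    simp only [hr, map_add, map_sub, Derivation.leibniz, smul_eq_mul,
      euler_Y, C.euler_hor hG, hP, hR, hθ, Derivation.map_ofNat]
    ring
  have hEa (k l : Fin n) : C.euler (a k l) = 0 := by
    simp only [ha, map_add, map_sub, Derivation.map_three_mul, euler_Y, C.euler_hor hG, hP, hθ]
    simp
  have haa : ∑ k, (∑ l, a k l * C.y l) * C.y k = 0 := by
    have h1 : ∑ k, (∑ l, a k l * C.y l) * C.y k = - ∑ k, (∑ l, a k l * C.y l) * C.y k := by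
      conv_lhs => simp only [Finset.sum_mul]
      rw [Finset.sum_comm]
      simp only [Finset.sum_mul, ← Finset.sum_neg_distrib]
      refine Finset.sum_congr rfl fun k _ => Finset.sum_congr rfl fun l _ => ?_
      simp only [ha]
      ring
    refine eq_zero_of_algebraMap_mul (r := 2) two_ne_zero ?_
    rw [map_ofNat]
    linear_combination h1
  set c : A := algebraMap ℝ A (1 / 3) with hc
  have hc3 : c * 3 = 1 := by
    rw [hc, ← map_ofNat (algebraMap ℝ A) 3, ← map_mul]
    norm_num
  refine ⟨c * ∑ l, r l * C.y l, fun k => c * (∑ l, a k l * C.y l - r k), fun k => ?_, ?_,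
    fun i k => ?_⟩
  · rw [hc, Derivation.map_algebraMap_mul]
    simp [hEa, hEr, euler_y]
  · simp only [mul_assoc, ← Finset.mul_sum, sub_mul, Finset.sum_sub_distrib, haa]
    ring
  · have h3 : 3 * C.riem G' i k
        = (if i = k then ∑ l, r l * C.y l else 0) + (∑ l, a k l * C.y l - r k) * C.y i := by
      rw [C.riem_eq (C.euler_proj hG hP hG'), Finset.mul_sum]
      simp only [← mul_assoc, hcurv, add_mul, sub_mul, Finset.sum_add_distrib,
        Finset.sum_sub_distrib, ite_mul, zero_mul, Finset.sum_ite_eq, Finset.mem_univ, if_true,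
        mul_right_comm _ (C.y i), ← Finset.sum_mul]
      split_ifs
      · ring
      · simp only [Finset.sum_const_zero]
        ring
    split_ifs at h3 ⊢ <;> linear_combination c * h3 - C.riem G' i k * hc3

theorem two_mul_curv_of_isotropic (hG : ∀ i, C.euler (G i) = 2 * G i) {R : A} {θ : Fin n → A}
    (hθ : ∀ k, C.euler (θ k) = θ k) (hRθ : ∑ k, θ k * C.y k = -R)
    (h : ∀ i k, C.riem G i k = R * (if i = k then 1 else 0) + θ k * C.y i)
    (htr : ∀ k l, C.hor G k (C.Y l (∑ m, C.conn G m m)) = C.hor G l (C.Y k (∑ m, C.conn G m m)))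
    (i k l : Fin n) :
    2 * C.curv G i k l = (if i = k then C.Y l R else 0) - (if i = l then C.Y k R else 0) := by
  have hsymm (k l : Fin n) : C.Y l (θ k) = C.Y k (θ l) := by
    set a := C.Y l (θ k) - C.Y k (θ l) with ha
    have hEa : ∑ m, C.y m * C.Y m a = 0 := by
      rw [← euler_apply, ha, map_sub, euler_Y, euler_Y, hθ, hθ]
      ring
    have h1 : ∑ m, C.Y m (3 * C.curv G m k l) = 0 := by
      simp only [Derivation.map_three_mul, ← Finset.mul_sum]
      rw [trace_Y_curv, htr, sub_self, mul_zero]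
    have hite (m k : Fin n) (b : A) :
        C.Y m (if m = k then b else 0) = if m = k then C.Y m b else 0 := by
      split_ifs <;> simp
    simp only [C.three_mul_curv_of_isotropic hG h, map_add, map_sub, hite, ← ha,
      Derivation.leibniz, smul_eq_mul, Y_y, Finset.sum_add_distrib, Finset.sum_sub_distrib, hEa]
      at h1
    simp at h1
    rw [C.Y_comm k l] at h1
    rw [← sub_eq_zero]
    refine eq_zero_of_algebraMap_mul (r := n + 1) (by positivity) ?_
    simp only [map_add, map_natCast, map_one]
    linear_combination h1
  have h2θ (l : Fin n) : 2 * θ l = - C.Y l R := by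
    have h1 := congrArg (C.Y l) hRθ
    simp only [map_sum, map_neg, Derivation.leibniz, smul_eq_mul, Y_y, hsymm _ l,
      Finset.sum_add_distrib] at h1
    rw [← euler_apply, hθ] at h1
    simp at h1
    linear_combination h1
  have h3 := C.three_mul_curv_of_isotropic hG h i k l
  rw [hsymm k l, sub_self, zero_mul, add_zero] at h3
  rw [← sub_eq_zero]
  refine eq_zero_of_algebraMap_mul (r := 3) three_ne_zero ?_
  rw [map_ofNat]
  split_ifs at h3 ⊢
  · linear_combination 2 * h3 - h2θ l + h2θ k
  · linear_combination 2 * h3 - h2θ l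
  · linear_combination 2 * h3 + h2θ k
  · linear_combination 2 * h3

theorem hor_Y_symm_of_curv (hn : 3 ≤ n) {R : A}
    (h : ∀ i k l, 2 * C.curv G i k l
      = (if i = k then C.Y l R else 0) - (if i = l then C.Y k R else 0)) (m l : Fin n) :
    C.hor G m (C.Y l R) = C.hor G l (C.Y m R) := by
  obtain ⟨k, hk⟩ : ∃ k, k ∉ ({m, l} : Finset (Fin n)) := by
    by_contra! hcon
    have h1 := Finset.card_le_card (fun k _ => hcon k : Finset.univ ⊆ ({m, l} : Finset (Fin n)))
    have h2 := Finset.card_le_two (a := m) (b := l)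
    rw [Finset.card_fin] at h1
    omega
  simp only [Finset.mem_insert, Finset.mem_singleton, not_or] at hk
  have hb := C.bianchi_hor G k m k l
  have hsum (u v w : Fin n) : 2 * ∑ s, C.curv G s u v * C.berwald G k w s
      = C.Y v R * C.berwald G k w u - C.Y u R * C.berwald G k w v := by
    simp only [Finset.mul_sum, ← mul_assoc, h, sub_mul, ite_mul, zero_mul, Finset.sum_sub_distrib,
      Finset.sum_ite_eq', Finset.mem_univ, if_true]
  have e1 : C.hor G m (2 * C.curv G k k l) = C.hor G m (C.Y l R) := by
    simp [h, hk.2]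
  have e2 : C.hor G k (2 * C.curv G k l m) = 0 := by
    simp [h, hk.1, hk.2]
  have e3 : C.hor G l (2 * C.curv G k m k) = - C.hor G l (C.Y m R) := by
    simp [h, hk.1]
  rw [Derivation.map_two_mul] at e1 e2 e3
  have s1 := hsum k l m
  have s2 := hsum l m k
  have s3 := hsum m k l
  rw [C.berwald_symm G k m k] at s1
  rw [C.berwald_symm G k l m] at s3
  rw [C.berwald_symm G k l k] at s3
  linear_combination 2 * hb - e1 - e2 - e3 - s1 - s2 - s3

/-- Vanishing of the Berwald–Weyl curvature for an isotropic spray with closed trace. -/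
theorem berwaldWeyl_of_isotropic (hn : 3 ≤ n) (hG : ∀ i, C.euler (G i) = 2 * G i) {R : A}
    {θ : Fin n → A} (hθ : ∀ k, C.euler (θ k) = θ k) (hRθ : ∑ k, θ k * C.y k = -R)
    (h : ∀ i k, C.riem G i k = R * (if i = k then 1 else 0) + θ k * C.y i)
    (htr : ∀ k l, C.hor G k (C.Y l (∑ m, C.conn G m m)) = C.hor G l (C.Y k (∑ m, C.conn G m m)))
    (k : Fin n) :
    2 * C.hor G k R
      = ∑ m, (C.hor G m (C.Y k R) - ∑ l, C.Y l R * C.berwald G l k m) * C.y m := by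
  have hsymm := C.hor_Y_symm_of_curv hn (C.two_mul_curv_of_isotropic hG hθ hRθ h htr)
  have hER : ∑ m, C.y m * C.Y m R = 2 * R := by
    rw [← euler_apply, ← neg_eq_iff_eq_neg.mpr hRθ]
    simp only [map_neg, map_sum, Derivation.leibniz, smul_eq_mul, hθ, euler_y,
      Finset.sum_add_distrib]
    simp only [mul_comm (C.y _)]
    ring
  have h1 := congrArg (C.hor G k) hER
  simp only [map_sum, Derivation.leibniz, smul_eq_mul, hor_y, Derivation.map_ofNat,
    Finset.sum_add_distrib, mul_zero, add_zero] at h1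
  have h2 : ∑ m, (∑ l, C.Y l R * C.berwald G l k m) * C.y m = ∑ l, C.Y l R * C.conn G l k := by
    simp only [Finset.sum_mul]
    rw [Finset.sum_comm]
    refine Finset.sum_congr rfl fun l _ => ?_
    rw [← C.euler_conn hG, euler_apply, Finset.mul_sum]
    exact Finset.sum_congr rfl fun m _ => by rw [Y_conn]; ring
  simp only [sub_mul, Finset.sum_sub_distrib, h2, hsymm _ k]
  rw [← h1]
  simp only [mul_neg, Finset.sum_neg_distrib, mul_comm (C.y _)]
  ring

/-- Isotropic sprays have vanishing Berwald–Weyl curvature with respect to any volume form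
`exp f dx`. -/
theorem berwaldWeyl_proj_eq_zero (hn : 3 ≤ n) (hG : ∀ i, C.euler (G i) = 2 * G i) {R : A}
    {θ : Fin n → A} (hR : C.euler R = 2 * R) (hθ : ∀ k, C.euler (θ k) = θ k)
    (h : ∀ i k, C.riem G i k = R * (if i = k then 1 else 0) + θ k * C.y i)
    {f P : A} (hf : ∀ k, C.Y k f = 0)
    (hP : ((n : A) + 1) * P = ∑ m, C.y m * C.X m f - ∑ m, C.conn G m m)
    {G' : Fin n → A} (hG' : ∀ i, G' i = G i + P * C.y i)
    {ric : A} (hric : ((n : A) - 1) * ric = ∑ m, C.riem G' m m) (k : Fin n) :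
    2 * C.hor G' k ric
      = ∑ m, (C.hor G' m (C.Y k ric) - ∑ l, C.Y l ric * C.berwald G' l k m) * C.y m := by
  have hEf : C.euler f = 0 := by simp [euler_apply, hf]
  have hEP : C.euler P = P := by
    rw [← sub_eq_zero]
    refine eq_zero_of_algebraMap_mul (r := n + 1) (by positivity) ?_
    have h1 := congrArg C.euler hP
    simp only [Derivation.leibniz, smul_eq_mul, map_sub, map_sum, map_add, euler_X, hEf, euler_y,
      C.euler_conn hG, Derivation.map_natCast, Derivation.map_one_eq_zero, map_zero] at h1
    simp only [map_add, map_natCast, map_one]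
    simp only [mul_comm (C.X _ _), mul_zero, add_zero, zero_add] at h1
    linear_combination h1 - hP
  obtain ⟨R', θ', hθ', hRθ', h'⟩ := C.exists_isotropic_proj hG hR hθ h hEP hG'
  have htrace : ∑ m, C.conn G' m m = ∑ m, C.y m * C.X m f := by
    have h1 : ∑ m, C.conn G' m m = ∑ m, C.conn G m m + (n * P + C.euler P) := by
      simp only [conn, hG', map_add, Derivation.leibniz, smul_eq_mul, Y_y, euler_apply,
        Finset.sum_add_distrib]
      simp
    rw [h1, hEP]
    linear_combination hP
  have hYtrace (l : Fin n) : C.Y l (∑ m, C.conn G' m m) = C.X l f := by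
    simp [htrace, YX_comm, hf, Y_y]
  have hricR : ric = R' := by
    rw [← sub_eq_zero]
    have hn' : (n : ℝ) - 1 ≠ 0 := by
      have : (3 : ℝ) ≤ n := by exact_mod_cast hn
      linarith
    refine eq_zero_of_algebraMap_mul hn' ?_
    simp only [map_sub, map_natCast, map_one]
    simp only [h', Finset.sum_add_distrib, hRθ', if_true, mul_one, Finset.sum_const,
      Finset.card_fin, nsmul_eq_mul] at hric
    linear_combination hric
  rw [hricR]
  refine C.berwaldWeyl_of_isotropic hn (C.euler_proj hG hEP hG') hθ' hRθ' h' (fun k l => ?_) k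
  simp [hYtrace, hor_apply, YX_comm, hf, C.X_comm k l]

end SlitCalculus

open scoped ContDiff

section SmoothFunctions

variable {E : Type*} {Ω : Set E}

/-- Extension by zero of a function on `Ω`. -/
def zeroExtend (f : Ω → ℝ) : E → ℝ := Function.extend (↑) f 0

theorem zeroExtend_coe (f : Ω → ℝ) (p : Ω) : zeroExtend f p = f p :=
  Subtype.val_injective.extend_apply ..

theorem eqOn_zeroExtend {f : Ω → ℝ} {F : E → ℝ} (h : ∀ p, f p = F p) :
    Set.EqOn (zeroExtend f) F Ω := fun p hp => (zeroExtend_coe f ⟨p, hp⟩).trans (h ⟨p, hp⟩)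

variable [NormedAddCommGroup E] [NormedSpace ℝ E]

variable (Ω) in
/-- The algebra of smooth functions on a subset `Ω` of a normed space. -/
def smoothFunctions : Subalgebra ℝ (Ω → ℝ) where
  carrier := {f | ContDiffOn ℝ ∞ (zeroExtend f) Ω}
  mul_mem' {f g} hf hg := (hf.mul hg).congr <| eqOn_zeroExtend fun p => by
    simp [zeroExtend_coe]
  add_mem' {f g} hf hg := (hf.add hg).congr <| eqOn_zeroExtend fun p => by
    simp [zeroExtend_coe]
  algebraMap_mem' r := (contDiffOn_const (c := r)).congr <| eqOn_zeroExtend fun _ => rfl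

/-- The restriction to `Ω` of a function smooth on `Ω`. -/
def restrictSmooth (F : E → ℝ) (hF : ContDiffOn ℝ ∞ F Ω) : smoothFunctions Ω :=
  ⟨fun p => F p, hF.congr <| eqOn_zeroExtend fun _ => rfl⟩

theorem differentiableAt_zeroExtend (hΩ : IsOpen Ω) (f : smoothFunctions Ω) (p : Ω) :
    DifferentiableAt ℝ (zeroExtend f.1) p :=
  (ContDiffOn.contDiffAt f.2 (hΩ.mem_nhds p.2)).differentiableAt (by simp)

theorem contDiffOn_fderiv_zeroExtend (hΩ : IsOpen Ω) (f : smoothFunctions Ω) (v : E) :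
    ContDiffOn ℝ ∞ (fun p => fderiv ℝ (zeroExtend f.1) p v) Ω :=
  (ContDiffOn.fderiv_of_isOpen f.2 hΩ (by simp)).clm_apply contDiffOn_const

theorem fderiv_zeroExtend (hΩ : IsOpen Ω) {f : Ω → ℝ} {F : E → ℝ} (h : ∀ p, f p = F p) (p : Ω) :
    fderiv ℝ (zeroExtend f) p = fderiv ℝ F p :=
  ((eqOn_zeroExtend h).eventuallyEq_of_mem (hΩ.mem_nhds p.2)).fderiv_eq

/-- Directional differentiation as a derivation of the algebra of smooth functions. -/
def directionalDerivation (hΩ : IsOpen Ω) (v : E) :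
    Derivation ℝ (smoothFunctions Ω) (smoothFunctions Ω) :=
  Derivation.mk'
    { toFun := fun f => restrictSmooth _ (contDiffOn_fderiv_zeroExtend hΩ f v)
      map_add' := fun f g => by
        ext p
        change fderiv ℝ (zeroExtend (f.1 + g.1)) p v
          = fderiv ℝ (zeroExtend f.1) p v + fderiv ℝ (zeroExtend g.1) p v
        rw [fderiv_zeroExtend hΩ (F := zeroExtend f.1 + zeroExtend g.1)
          (fun p => by simp [zeroExtend_coe]) p, fderiv_add (differentiableAt_zeroExtend hΩ f p)
          (differentiableAt_zeroExtend hΩ g p)]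
        rfl
      map_smul' := fun c f => by
        ext p
        change fderiv ℝ (zeroExtend (c • f.1)) p v = c * fderiv ℝ (zeroExtend f.1) p v
        rw [fderiv_zeroExtend hΩ (F := c • zeroExtend f.1)
          (fun p => by simp [zeroExtend_coe]) p,
          fderiv_const_smul (differentiableAt_zeroExtend hΩ f p)]
        rfl }
    fun f g => by
      ext p
      change fderiv ℝ (zeroExtend (f.1 * g.1)) p v
        = f.1 p * fderiv ℝ (zeroExtend g.1) p v + g.1 p * fderiv ℝ (zeroExtend f.1) p v
      rw [fderiv_zeroExtend hΩ (F := zeroExtend f.1 * zeroExtend g.1)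
        (fun p => by simp [zeroExtend_coe]) p, fderiv_mul (differentiableAt_zeroExtend hΩ f p)
        (differentiableAt_zeroExtend hΩ g p)]
      simp [zeroExtend_coe]

theorem directionalDerivation_apply (hΩ : IsOpen Ω) (v : E) (f : smoothFunctions Ω) {F : E → ℝ}
    (h : ∀ p, f.1 p = F p) (p : Ω) :
    (directionalDerivation hΩ v f).1 p = fderiv ℝ F p v := by
  rw [← fderiv_zeroExtend hΩ h p]
  rfl

theorem directionalDerivation_comm (hΩ : IsOpen Ω) (v w : E) (f : smoothFunctions Ω) :
    directionalDerivation hΩ v (directionalDerivation hΩ w f)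
      = directionalDerivation hΩ w (directionalDerivation hΩ v f) := by
  have key (v w : E) (p : Ω) : (directionalDerivation hΩ v (directionalDerivation hΩ w f)).1 p
      = fderiv ℝ (fderiv ℝ (zeroExtend f.1)) p v w := by
    rw [directionalDerivation_apply hΩ v _ (F := fun q => fderiv ℝ (zeroExtend f.1) q w)
      (fun _ => rfl)]
    have hd : DifferentiableAt ℝ (fderiv ℝ (zeroExtend f.1)) p :=
      ((ContDiffOn.fderiv_of_isOpen f.2 hΩ (m := ∞) (by simp)).contDiffAt
        (hΩ.mem_nhds p.2)).differentiableAt (by simp)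
    rw [fderiv_clm_apply hd (differentiableAt_const w)]
    simp
  ext p
  rw [key, key]
  exact (ContDiffOn.contDiffAt f.2 (hΩ.mem_nhds p.2)).isSymmSndFDerivAt (by
    rw [minSmoothness_of_isRCLikeNormedField]
    exact WithTop.coe_le_coe.2 (le_top : (2 : ℕ∞) ≤ ⊤)) v w

end SmoothFunctions

variable {n : ℕ} {U : Set (Vec n)}

theorem isOpen_prod_slit (hU : IsOpen U) : IsOpen (U ×ˢ slit n) :=
  hU.prod isOpen_compl_singleton

/-- The fibre coordinate `y^i`. -/
def fibreCoord (U : Set (Vec n)) (i : Fin n) : smoothFunctions (U ×ˢ slit n) :=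
  restrictSmooth (fun p : Vec n × Vec n => p.2 i) (by fun_prop)

theorem fderiv_fibreCoord (i : Fin n) (p v : Vec n × Vec n) :
    fderiv ℝ (fun p : Vec n × Vec n => p.2 i) p v = v.2 i := by
  have h : HasFDerivAt (fun p : Vec n × Vec n => p.2 i)
      ((ContinuousLinearMap.proj (R := ℝ) (φ := fun _ : Fin n => ℝ) i).comp
        (ContinuousLinearMap.snd ℝ (Vec n) (Vec n))) p :=
    ((ContinuousLinearMap.proj (R := ℝ) (φ := fun _ : Fin n => ℝ) i).comp
      (ContinuousLinearMap.snd ℝ (Vec n) (Vec n))).hasFDerivAt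
  rw [h.fderiv]
  rfl

/-- The coordinate vector fields on `U × (ℝⁿ \ {0})`. -/
def slitCalculus (hU : IsOpen U) : SlitCalculus (smoothFunctions (U ×ˢ slit n)) n where
  X i := directionalDerivation (isOpen_prod_slit hU) (Pi.single i 1, 0)
  Y i := directionalDerivation (isOpen_prod_slit hU) (0, Pi.single i 1)
  y := fibreCoord U
  X_comm _ _ _ := directionalDerivation_comm ..
  Y_comm _ _ _ := directionalDerivation_comm ..
  YX_comm _ _ _ := directionalDerivation_comm ..
  X_y i j := by
    ext p
    rw [directionalDerivation_apply _ _ _ (F := fun q : Vec n × Vec n => q.2 j) (fun _ => rfl),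
      fderiv_fibreCoord]
    rfl
  Y_y i j := by
    ext p
    rw [directionalDerivation_apply _ _ _ (F := fun q : Vec n × Vec n => q.2 j) (fun _ => rfl),
      fderiv_fibreCoord]
    simp only [Pi.single_apply]
    split_ifs <;> rfl

/-- `a` is the restriction of `F` to `U × (ℝⁿ \ {0})`, and it is homogeneous of degree `d` in the
fibre variable. -/
def Represents (hU : IsOpen U) (d : ℤ) (F : Vec n → Vec n → ℝ)
    (a : smoothFunctions (U ×ˢ slit n)) : Prop :=
  (∀ p, a.1 p = F p.1.1 p.1.2) ∧ (slitCalculus hU).euler a = d * a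

namespace Represents

variable {hU : IsOpen U} {d e : ℤ} {F F' : Vec n → Vec n → ℝ}
  {a b : smoothFunctions (U ×ˢ slit n)}

theorem add (h : Represents hU d F a) (h' : Represents hU d F' b) :
    Represents hU d (fun x y => F x y + F' x y) (a + b) :=
  ⟨fun p => by beta_reduce; rw [← h.1, ← h'.1]; rfl, by rw [map_add, h.2, h'.2]; ring⟩

theorem sub (h : Represents hU d F a) (h' : Represents hU d F' b) :
    Represents hU d (fun x y => F x y - F' x y) (a - b) :=
  ⟨fun p => by beta_reduce; rw [← h.1, ← h'.1]; rfl, by rw [map_sub, h.2, h'.2]; ring⟩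

theorem mul (h : Represents hU d F a) (h' : Represents hU e F' b) {s : ℤ} (hs : d + e = s) :
    Represents hU s (fun x y => F x y * F' x y) (a * b) :=
  ⟨fun p => by beta_reduce; rw [← h.1, ← h'.1]; rfl, by
    rw [Derivation.leibniz, h.2, h'.2, ← hs]
    simp only [smul_eq_mul]
    push_cast
    ring⟩

theorem const_mul (c : ℝ) (h : Represents hU d F a) :
    Represents hU d (fun x y => c * F x y) (algebraMap ℝ _ c * a) :=
  ⟨fun p => by beta_reduce; rw [← h.1]; rfl, by rw [Derivation.map_algebraMap_mul, h.2]; ring⟩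

theorem sum {F : Fin n → Vec n → Vec n → ℝ} {a : Fin n → smoothFunctions (U ×ˢ slit n)}
    (h : ∀ i, Represents hU d (F i) (a i)) :
    Represents hU d (fun x y => ∑ i, F i x y) (∑ i, a i) :=
  ⟨fun p => by
    simp only [← fun i => (h i).1 p]
    rw [AddSubmonoidClass.coe_finsetSum, Finset.sum_apply], by
    simp only [map_sum, (h _).2, Finset.mul_sum]⟩

theorem congr (h : Represents hU d F a) (hF : ∀ x y, F x y = F' x y) : Represents hU d F' a :=
  ⟨fun p => by rw [h.1, hF], h.2⟩

theorem fibreCoord (i : Fin n) : Represents hU 1 (fun _ y => y i) (fibreCoord U i) :=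
  ⟨fun _ => rfl, by rw [Int.cast_one, one_mul]; exact (slitCalculus hU).euler_y i⟩

theorem hasFDerivAt (h : Represents hU d F a) (p : (U ×ˢ slit n : Set _)) :
    HasFDerivAt (fun q : Vec n × Vec n => F q.1 q.2)
      (fderiv ℝ (fun q : Vec n × Vec n => F q.1 q.2) p) p := by
  refine DifferentiableAt.hasFDerivAt ?_
  refine (differentiableAt_zeroExtend (isOpen_prod_slit hU) a p).congr_of_eventuallyEq ?_
  exact ((eqOn_zeroExtend (F := fun q : Vec n × Vec n => F q.1 q.2) h.1).eventuallyEq_of_mem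
    ((isOpen_prod_slit hU).mem_nhds p.2)).symm

theorem X_apply (h : Represents hU d F a) (i : Fin n) (p : (U ×ˢ slit n : Set _)) :
    ((slitCalculus hU).X i a).1 p = pdx F i p.1.1 p.1.2 := by
  have h1 : HasFDerivAt (fun x => F x p.1.2) _ p.1.1 :=
    HasFDerivAt.comp (g := fun q : Vec n × Vec n => F q.1 q.2) (f := fun x => (x, p.1.2)) p.1.1
      (h.hasFDerivAt p) (hasFDerivAt_prodMk_left p.1.1 p.1.2)
  rw [pdx, h1.fderiv]
  exact directionalDerivation_apply (F := fun q : Vec n × Vec n => F q.1 q.2)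
    (isOpen_prod_slit hU) _ a h.1 p

theorem Y_apply (h : Represents hU d F a) (i : Fin n) (p : (U ×ˢ slit n : Set _)) :
    ((slitCalculus hU).Y i a).1 p = pdy F i p.1.1 p.1.2 := by
  have h1 : HasFDerivAt (fun y => F p.1.1 y) _ p.1.2 :=
    HasFDerivAt.comp (g := fun q : Vec n × Vec n => F q.1 q.2) (f := fun y => (p.1.1, y)) p.1.2
      (h.hasFDerivAt p) (hasFDerivAt_prodMk_right p.1.1 p.1.2)
  rw [pdy, h1.fderiv]
  exact directionalDerivation_apply (F := fun q : Vec n × Vec n => F q.1 q.2)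
    (isOpen_prod_slit hU) _ a h.1 p

theorem pdx (h : Represents hU d F a) (i : Fin n) :
    Represents hU d (pdx F i) ((slitCalculus hU).X i a) :=
  ⟨h.X_apply i, by
    rw [SlitCalculus.euler_X, h.2, Derivation.leibniz, ← smul_eq_mul, Derivation.map_intCast]
    simp⟩

theorem pdy (h : Represents hU (d + 1) F a) (i : Fin n) :
    Represents hU d (pdy F i) ((slitCalculus hU).Y i a) :=
  ⟨h.Y_apply i, by
    rw [SlitCalculus.euler_Y, h.2, Derivation.leibniz, ← smul_eq_mul, Derivation.map_intCast]
    simp [add_mul]⟩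

theorem ite_mul (P : Prop) [Decidable P] (h : Represents hU d F a) :
    Represents hU d (fun x y => F x y * if P then 1 else 0) (a * if P then 1 else 0) := by
  split_ifs
  · simpa using h
  · exact ⟨fun p => by simp, by simp⟩

section Spray

variable {G : Fin n → Vec n → Vec n → ℝ} {g : Fin n → smoothFunctions (U ×ˢ slit n)}

theorem Nc (h : ∀ i, Represents hU 2 (G i) (g i)) (i k : Fin n) :
    Represents hU 1 (Nc G i k) ((slitCalculus hU).conn g i k) := (h i).pdy k

theorem Γc (h : ∀ i, Represents hU 2 (G i) (g i)) (i j k : Fin n) :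
    Represents hU 0 (Γc G i j k) ((slitCalculus hU).berwald g i j k) := (Nc h i j).pdy k

theorem hD (h : ∀ i, Represents hU 2 (G i) (g i)) (hF : Represents hU (d + 1) F a) (k : Fin n) :
    Represents hU (d + 1) (hD G F k) ((slitCalculus hU).hor g k a) := by
  rw [SlitCalculus.hor_apply]
  exact (hF.pdx k).sub (sum fun l => (Nc h l k).mul (hF.pdy l) (add_comm ..))

theorem Riem (h : ∀ i, Represents hU 2 (G i) (g i)) (i k : Fin n) :
    Represents hU 2 (Riem G i k) ((slitCalculus hU).riem g i k) := by
  have h1 := ((((h i).pdx k).const_mul 2).sub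
    (sum fun j => (fibreCoord j).mul (((h i).pdx j).pdy (d := 1) k) (s := 2) rfl)).add
    ((sum fun j => (h j).mul (Γc h i j k) (s := 2) rfl).const_mul 2)
  exact h1.sub (sum fun s => (Nc h i s).mul (Nc h s k) rfl)

theorem Ricci (h : ∀ i, Represents hU 2 (G i) (g i)) :
    Represents hU 2 (Ricci G)
      (algebraMap ℝ _ ((n : ℝ) - 1)⁻¹ * ∑ m, (slitCalculus hU).riem g m m) :=
  ((sum fun m => Riem h m m).const_mul _).congr fun _ _ => (div_eq_inv_mul ..).symm

end Spray

end Represents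

theorem exists_represents_spray (hU : IsOpen U) {G : Fin n → Vec n → Vec n → ℝ}
    (hG : IsSpray U G) :
    ∃ g : Fin n → smoothFunctions (U ×ˢ slit n), ∀ i, Represents hU 2 (G i) (g i) := by
  refine ⟨fun i => restrictSmooth _ (hG.1 i), fun i => ⟨fun _ => rfl, ?_⟩⟩
  ext p
  obtain ⟨⟨x, y⟩, hx, hy⟩ := p
  have hΩ := isOpen_prod_slit hU
  have hd : DifferentiableAt ℝ (fun q : Vec n × Vec n => G i q.1 q.2) (x, y) :=
    ((hG.1 i).contDiffAt (hΩ.mem_nhds ⟨hx, hy⟩)).differentiableAt (by simp)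
  have h1 : ((slitCalculus hU).euler (restrictSmooth _ (hG.1 i))).1 ⟨(x, y), hx, hy⟩
      = fderiv ℝ (fun q : Vec n × Vec n => G i q.1 q.2) (x, y) (0, y) := by
    rw [SlitCalculus.euler_apply, AddSubmonoidClass.coe_finsetSum, Finset.sum_apply]
    have hy' : ((0, y) : Vec n × Vec n) = ∑ j, y j • (0, Pi.single j 1) := by
      refine Prod.ext ?_ ?_
      · simp [Prod.fst_sum]
      · simp only [Prod.snd_sum, Prod.smul_snd]
        exact pi_eq_sum_univ' y
    rw [hy', map_sum]
    refine Finset.sum_congr rfl fun j _ => ?_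
    rw [map_smul, smul_eq_mul]
    exact congrArg (y j * ·) (directionalDerivation_apply hΩ _ _
      (F := fun q : Vec n × Vec n => G i q.1 q.2) (fun _ => rfl) ⟨(x, y), hx, hy⟩)
  have h2 : HasDerivAt (fun c : ℝ => G i x (c • y))
      (fderiv ℝ (fun q : Vec n × Vec n => G i q.1 q.2) (x, y) (0, y)) 1 := by
    have hc : HasDerivAt (fun c : ℝ => ((x, c • y) : Vec n × Vec n)) (0, y) 1 := by
      simpa using (hasDerivAt_const (1 : ℝ) x).prodMk ((hasDerivAt_id (1 : ℝ)).smul_const y)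
    have hd' : HasFDerivAt (fun q : Vec n × Vec n => G i q.1 q.2)
      (fderiv ℝ (fun q : Vec n × Vec n => G i q.1 q.2) (x, y)) (x, (1 : ℝ) • y) := by
      rw [one_smul]; exact hd.hasFDerivAt
    exact hd'.comp_hasDerivAt (1 : ℝ) hc
  have h3 : HasDerivAt (fun c : ℝ => G i x (c • y)) (2 * G i x y) 1 := by
    have : HasDerivAt (fun c : ℝ => c ^ 2 * G i x y) (2 * G i x y) 1 := by
      simpa using (hasDerivAt_pow 2 (1 : ℝ)).mul_const (G i x y)
    refine this.congr_of_eventuallyEq ?_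
    filter_upwards [lt_mem_nhds zero_lt_one] with c hc
    exact hG.2 i x hx y hy c hc
  exact h1.trans (h2.unique h3)

theorem exists_represents_Tcurv {hU : IsOpen U} {G : Fin n → Vec n → Vec n → ℝ}
    {g : Fin n → smoothFunctions (U ×ˢ slit n)} (h : ∀ i, Represents hU 2 (G i) (g i))
    (i k : Fin n) : ∃ t, Represents hU 2 (Tcurv G i k) t :=
  ⟨_, (Represents.Riem h i k).sub (((Represents.Ricci h).ite_mul (i = k)).sub
    ((((Represents.Ricci h).pdy (d := 1) k).const_mul (1 / 2)).mul (.fibreCoord i) rfl))⟩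

theorem exists_represents_chiC {hU : IsOpen U} {G : Fin n → Vec n → Vec n → ℝ}
    {g : Fin n → smoothFunctions (U ×ˢ slit n)} (h : ∀ i, Represents hU 2 (G i) (g i))
    (k : Fin n) : ∃ c, Represents hU 1 (chiC G k) c := by
  choose t ht using fun m => exists_represents_Tcurv h m k
  exact ⟨_, (Represents.sum fun m => (ht m).pdy (d := 1) m).const_mul (-(1 / 3))⟩

/-- Vanishing Weyl curvature means that the Riemann curvature is isotropic. -/
theorem exists_isotropic_of_Weyl {hU : IsOpen U} {G : Fin n → Vec n → Vec n → ℝ}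
    {g : Fin n → smoothFunctions (U ×ˢ slit n)} (h : ∀ i, Represents hU 2 (G i) (g i))
    (hW : ∀ x ∈ U, ∀ y ∈ slit n, ∀ i k : Fin n, Weyl G i k x y = 0) :
    ∃ (R : smoothFunctions (U ×ˢ slit n)) (θ : Fin n → smoothFunctions (U ×ˢ slit n)),
      (slitCalculus hU).euler R = 2 * R ∧ (∀ k, (slitCalculus hU).euler (θ k) = θ k) ∧
      ∀ i k, (slitCalculus hU).riem g i k
        = R * (if i = k then 1 else 0) + θ k * (slitCalculus hU).y i := by
  choose c hc using exists_represents_chiC h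
  have hR := Represents.Ricci h
  have hθ (k : Fin n) := ((hR.pdy (d := 1) k).const_mul (-(1 / 2))).sub
    ((hc k).const_mul (3 / ((n : ℝ) + 1)))
  refine ⟨_, _, hR.2.trans (by simp), fun k => (hθ k).2.trans (by simp), fun i k => ?_⟩
  ext p
  have h1 := (Represents.Riem h i k).1 p
  have h2 := ((hR.ite_mul (i = k)).add ((hθ k).mul (.fibreCoord i) rfl)).1 p
  refine h1.trans (Eq.trans ?_ h2.symm)
  have h3 := hW _ p.2.1 _ p.2.2 i k
  simp only [Weyl, Tcurv] at h3
  linear_combination h3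

/-- Theorem 1.2: if a spray on `U ⊆ ℝⁿ`, `n ≥ 3`, is of scalar curvature (vanishing Weyl
curvature), then its Berwald–Weyl curvature vanishes for every volume form. -/
theorem stmt_2 {n : ℕ} (hn : 3 ≤ n) (U : Set (Vec n)) (hU : IsOpen U) (hUne : U.Nonempty)
    (G : Fin n → Vec n → Vec n → ℝ) (hG : IsSpray U G)
    (hW : ∀ x ∈ U, ∀ y ∈ slit n, ∀ i k : Fin n, Weyl G i k x y = 0) :
    ∀ σ : Vec n → ℝ, IsVolumeForm U σ →
      ∀ x ∈ U, ∀ y ∈ slit n, ∀ k : Fin n, BWeyl G σ k x y = 0 := by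
  intro σ hσ x hx y hy k
  obtain ⟨g, hg⟩ := exists_represents_spray hU hG
  obtain ⟨R, θ, hR, hθ, hRiem⟩ := exists_isotropic_of_Weyl hg hW
  have hn1 : (n : ℝ) + 1 ≠ 0 := by positivity
  have hn2 : (n : ℝ) - 1 ≠ 0 := by
    have : (3 : ℝ) ≤ n := by exact_mod_cast hn
    linarith
  have hlog : ContDiffOn ℝ ∞ (fun p : Vec n × Vec n => Real.log (σ p.1)) (U ×ˢ slit n) :=
    (hσ.1.log fun x hx => (hσ.2 x hx).ne').comp contDiffOn_fst fun p hp => hp.1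
  set C := slitCalculus hU with hC
  set f := restrictSmooth _ hlog
  have hYf (j : Fin n) : C.Y j f = 0 := by
    ext p
    refine (directionalDerivation_apply (isOpen_prod_slit hU) _ f
      (F := fun q : Vec n × Vec n => Real.log (σ q.1)) (fun _ => rfl) p).trans ?_
    have hd : DifferentiableAt ℝ (fun q : Vec n × Vec n => Real.log (σ q.1)) p.1 :=
      (hlog.contDiffAt ((isOpen_prod_slit hU).mem_nhds p.2)).differentiableAt (by simp)
    have h1 := HasFDerivAt.comp (f := fun y => (p.1.1, y)) p.1.2 hd.hasFDerivAt
      (hasFDerivAt_prodMk_right p.1.1 p.1.2)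
    have h2 := h1.unique (hasFDerivAt_const (Real.log (σ p.1.1)) p.1.2)
    exact congrArg (· (Pi.single j 1)) h2
  have hfrep : Represents hU 0 (fun x _ => Real.log (σ x)) f :=
    ⟨fun _ => rfl, by rw [SlitCalculus.euler_apply]; simp [← hC, hYf]⟩
  have hS : Represents hU 1 (Scurv G σ) (∑ m, C.conn g m m - ∑ m, C.y m * C.X m f) :=
    (Represents.sum fun m => Represents.Nc hg m m).sub
      (Represents.sum fun m => (Represents.fibreCoord m).mul (hfrep.pdx m) rfl)
  set S := ∑ m, C.conn g m m - ∑ m, C.y m * C.X m f with hSdef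
  set P := algebraMap ℝ _ (-((n : ℝ) + 1)⁻¹) * S with hPdef
  have hghat (i : Fin n) : Represents hU 2 (Ghat G σ i) (g i + P * C.y i) :=
    ((hg i).add ((hS.const_mul _).mul (.fibreCoord i) rfl)).congr fun x y => by
      simp only [Ghat]
      ring
  have hP : ((n : smoothFunctions (U ×ˢ slit n)) + 1) * P
      = ∑ m, C.y m * C.X m f - ∑ m, C.conn g m m := by
    have h1 : ((n : smoothFunctions (U ×ˢ slit n)) + 1)
        * algebraMap ℝ _ (-((n : ℝ) + 1)⁻¹) = -1 := by
      rw [← map_natCast (algebraMap ℝ _), ← map_one (algebraMap ℝ _), ← map_add, ← map_mul,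
        ← map_neg]
      congr 1
      field_simp
    rw [hPdef, ← mul_assoc, h1, hSdef]
    ring
  have hric := Represents.Ricci hghat
  set ric := algebraMap ℝ (smoothFunctions (U ×ˢ slit n)) ((n : ℝ) - 1)⁻¹
    * ∑ m, C.riem (fun i => g i + P * C.y i) m m with hricdef
  have hric' : ((n : smoothFunctions (U ×ˢ slit n)) - 1) * ric
      = ∑ m, C.riem (fun i => g i + P * C.y i) m m := by
    rw [hricdef, ← mul_assoc, ← map_natCast (algebraMap ℝ _), ← map_one (algebraMap ℝ _),
      ← map_sub, ← map_mul, mul_inv_cancel₀ hn2, map_one, one_mul]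
  have key := C.berwaldWeyl_proj_eq_zero hn (fun i => by simpa using (hg i).2) hR hθ hRiem hYf hP
    (fun _ => rfl) hric' k
  have hY (j : Fin n) := hric.pdy (d := 1) j
  have h1 := ((Represents.hD hghat (d := 1) hric k).const_mul 2).1 ⟨(x, y), hx, hy⟩
  have h2 := (Represents.sum fun m => ((Represents.hD hghat (d := 0) (hY k) m).sub
    (Represents.sum fun l => (hY l).mul (Represents.Γc hghat l k m) rfl)).mul
      (.fibreCoord m) (s := 2) rfl).1 ⟨(x, y), hx, hy⟩
  have h3 := h1.symm.trans ((congrArg (fun a => a.1 ⟨(x, y), hx, hy⟩) key).trans h2)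
  simp only [BWeyl, covD1]
  linear_combination (1 / 2) * h3

end BerwaldWeyl
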